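/- Weighted L² estimate for the linear-in-η error term: there exist constants δ₀ > 0 and C > 0 such that for every κ > 0, every δ ∈ (0, δ₀), every z ∈ ℂ² with |z| ≤ δ, and every measurable η₁ : ℝ → ℝ, one has ‖ sech(κx) (f'(Φ[z]₁) - f'(Q)) η₁ ‖_{L²(ℝ)} ≤ C δ^{p-1} ‖ sech((κ + (p-1)k₂) x) η₁ ‖_{L²(ℝ)}, where f'(u) = p|u|^{p-1}. -/

import Mathlib

open Real

/-- The soliton `Q(x) = ((p+1)/2)^{1/(p-1)} (sech(β₀x))^{2/(p-1)}` with `β₀ = (p-1)/2`,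
where `sech t = 1 / cosh t`. -/
noncomputable def solitonQ (p : ℝ) : ℝ → ℝ :=
  fun x => ((p + 1) / 2) ^ (1 / (p - 1)) * ((Real.cosh ((p - 1) / 2 * x))⁻¹) ^ (2 / (p - 1))

/-- The nonlinearity `f(u) = |u|^{p-1} u`. -/
noncomputable def fNL (p : ℝ) : ℝ → ℝ :=
  fun u => |u| ^ (p - 1) * u

/-- The operator `(S_j* g)(x) = -g'(x) - k tanh(β₀x) g(x)` with `β₀ = (p-1)/2`,
for a constant `k`. -/
noncomputable def Sstar (p k : ℝ) (g : ℝ → ℝ) : ℝ → ℝ :=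
  fun x => -(deriv g x) - k * Real.tanh ((p - 1) / 2 * x) * g x

/-- `φ₀ = Q^{k₀}` with `k₀ = (p+1)/2`. -/
noncomputable def phi0 (p : ℝ) : ℝ → ℝ :=
  fun x => solitonQ p x ^ ((p + 1) / 2)

/-- `φ₂ = S₀*(S₁*(Q^{k₂}))` where `k₀ = (p+1)/2`, `k₁ = 1`, `k₂ = (3-p)/2`. -/
noncomputable def phi2 (p : ℝ) : ℝ → ℝ :=
  Sstar p ((p + 1) / 2) (Sstar p 1 (fun x => solitonQ p x ^ ((3 - p) / 2)))

open MeasureTheory Complex in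
/-- `Φ[z]₁ = Q + Re((1-i)z₁) φ₀ + 2 Re(z₂) φ₂` for `z = (z₁, z₂) ∈ ℂ²`. -/
noncomputable def PhiZ1 (p : ℝ) (z : ℂ × ℂ) : ℝ → ℝ :=
  fun x => solitonQ p x + ((1 - Complex.I) * z.1).re * phi0 p x + 2 * z.2.re * phi2 p x

lemma solitonQ_pos {p : ℝ} (hp : -1 < p) (x : ℝ) : 0 < solitonQ p x := by
  have h : 0 < (p + 1) / 2 := by linarith
  have hc := Real.cosh_pos ((p - 1) / 2 * x)
  unfold solitonQ
  positivity

lemma hasDerivAt_tanh_const_mul (b x : ℝ) :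
    HasDerivAt (fun y => Real.tanh (b * y)) (b * (1 - Real.tanh (b * x) ^ 2)) x := by
  have hc := (Real.cosh_pos (b * x)).ne'
  have hl : HasDerivAt (fun y : ℝ => b * y) b x := by
    simpa using (hasDerivAt_id x).const_mul b
  have h := hl.sinh.div hl.cosh hc
  simp only [Real.tanh_eq_sinh_div_cosh]
  refine h.congr_deriv ?_
  field_simp

lemma hasDerivAt_solitonQ {p : ℝ} (hp : 1 < p) (x : ℝ) :
    HasDerivAt (solitonQ p) (-(Real.tanh ((p - 1) / 2 * x) * solitonQ p x)) x := by
  have hc := Real.cosh_pos ((p - 1) / 2 * x)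
  have hl : HasDerivAt (fun y : ℝ => (p - 1) / 2 * y) ((p - 1) / 2) x := by
    simpa using (hasDerivAt_id x).const_mul ((p - 1) / 2)
  have h := ((hl.cosh.fun_inv hc.ne').rpow_const (p := 2 / (p - 1))
    (Or.inl (inv_ne_zero hc.ne'))).const_mul (((p + 1) / 2) ^ (1 / (p - 1)))
  refine h.congr_deriv ?_
  have hp' : p - 1 ≠ 0 := by linarith
  rw [Real.rpow_sub_one (inv_ne_zero hc.ne'), Real.tanh_eq_sinh_div_cosh]
  unfold solitonQ
  field_simp

lemma hasDerivAt_solitonQ_rpow {p : ℝ} (hp : 1 < p) (a x : ℝ) :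
    HasDerivAt (fun y => solitonQ p y ^ a)
      (-(a * Real.tanh ((p - 1) / 2 * x) * solitonQ p x ^ a)) x := by
  have hQ := (solitonQ_pos (by linarith : -1 < p) x).ne'
  refine ((hasDerivAt_solitonQ hp x).rpow_const (p := a) (Or.inl hQ)).congr_deriv ?_
  rw [Real.rpow_sub_one hQ]
  field_simp

lemma phi2_eq {p : ℝ} (hp : 1 < p) (x : ℝ) :
    phi2 p x = ((p - 1) / 2) ^ 2 * (1 + Real.tanh ((p - 1) / 2 * x) ^ 2) *
      solitonQ p x ^ ((3 - p) / 2) := by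
  have hS : Sstar p 1 (fun x => solitonQ p x ^ ((3 - p) / 2)) = fun x =>
      -((p - 1) / 2) * (Real.tanh ((p - 1) / 2 * x) * solitonQ p x ^ ((3 - p) / 2)) := by
    funext y
    simp only [Sstar, (hasDerivAt_solitonQ_rpow hp _ y).deriv]
    ring
  have hd := ((hasDerivAt_tanh_const_mul ((p - 1) / 2) x).fun_mul
    (hasDerivAt_solitonQ_rpow hp ((3 - p) / 2) x)).const_mul (-((p - 1) / 2))
  simp only [phi2, hS]
  simp only [Sstar, hd.deriv]
  ring

lemma abs_phi2_le {p : ℝ} (hp1 : 1 < p) (hp2 : p ≤ 2) (x : ℝ) :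
    |phi2 p x| ≤ solitonQ p x ^ ((3 - p) / 2) := by
  have hG := Real.rpow_nonneg (solitonQ_pos (by linarith : -1 < p) x).le ((3 - p) / 2)
  have ht := Real.tanh_sq_lt_one ((p - 1) / 2 * x)
  rw [phi2_eq hp1, abs_of_nonneg (by positivity)]
  refine mul_le_of_le_one_left hG ?_
  have hb : ((p - 1) / 2) ^ 2 ≤ 1 / 4 := by nlinarith
  nlinarith [sq_nonneg (Real.tanh ((p - 1) / 2 * x))]

lemma inv_cosh_le_two_mul_exp_neg_abs (x : ℝ) : (Real.cosh x)⁻¹ ≤ 2 * Real.exp (-|x|) := by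
  rw [Real.exp_neg, ← Real.cosh_abs x, ← div_eq_mul_inv, inv_le_comm₀ (Real.cosh_pos _)
    (by positivity), inv_div, Real.cosh_eq]
  linarith [Real.exp_pos (-|x|)]

lemma exp_neg_abs_le_inv_cosh (x : ℝ) : Real.exp (-|x|) ≤ (Real.cosh x)⁻¹ := by
  rw [Real.exp_neg, ← Real.cosh_abs x]
  refine inv_anti₀ (Real.cosh_pos _) ?_
  rw [Real.cosh_eq]
  have : Real.exp (-|x|) ≤ Real.exp |x| := Real.exp_le_exp.2 (by linarith [abs_nonneg x])
  linarith

lemma solitonQ_le {p : ℝ} (hp : 1 < p) (x : ℝ) :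
    solitonQ p x ≤
      ((p + 1) / 2) ^ (1 / (p - 1)) * 2 ^ (2 / (p - 1)) * Real.exp (-|x|) := by
  have hp' : 0 < p - 1 := by linarith
  have hc := Real.cosh_pos ((p - 1) / 2 * x)
  unfold solitonQ
  rw [mul_assoc]
  gcongr
  calc ((Real.cosh ((p - 1) / 2 * x))⁻¹) ^ (2 / (p - 1))
      ≤ (2 * Real.exp (-|(p - 1) / 2 * x|)) ^ (2 / (p - 1)) := by
        gcongr
        exact inv_cosh_le_two_mul_exp_neg_abs _
    _ = 2 ^ (2 / (p - 1)) * Real.exp (-|x|) := by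
        rw [Real.mul_rpow (by norm_num) (Real.exp_pos _).le, ← Real.exp_mul, abs_mul,
          abs_of_pos (by positivity : 0 < (p - 1) / 2)]
        congr 2
        field_simp

lemma solitonQ_rpow_le {p : ℝ} (hp : 1 < p) {a b : ℝ} (hb : 0 ≤ b) (hba : b ≤ a) (x : ℝ) :
    solitonQ p x ^ a ≤
      (((p + 1) / 2) ^ (1 / (p - 1)) * 2 ^ (2 / (p - 1))) ^ a * Real.exp (-(b * |x|)) := by
  have hQ := solitonQ_pos (by linarith : -1 < p) x
  have hM : 0 < ((p + 1) / 2) ^ (1 / (p - 1)) * (2 : ℝ) ^ (2 / (p - 1)) := by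
    have : 0 < (p + 1) / 2 := by linarith
    positivity
  refine (Real.rpow_le_rpow hQ.le (solitonQ_le hp x) (hb.trans hba)).trans ?_
  rw [Real.mul_rpow hM.le (Real.exp_pos _).le, ← Real.exp_mul]
  gcongr
  nlinarith [mul_le_mul_of_nonneg_right hba (abs_nonneg x)]

lemma abs_abs_rpow_sub_abs_rpow_le {s : ℝ} (hs0 : 0 ≤ s) (hs1 : s ≤ 1) (a b : ℝ) :
    |(|a| ^ s - |b| ^ s)| ≤ |a - b| ^ s := by
  have key : ∀ u v : ℝ, |u| ^ s ≤ |u - v| ^ s + |v| ^ s := fun u v =>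
    (Real.rpow_le_rpow (abs_nonneg u) (by simpa using abs_add_le (u - v) v) hs0).trans
      (Real.rpow_add_le_add_rpow (abs_nonneg _) (abs_nonneg _) hs0 hs1)
  rw [abs_le]
  have h := key b a
  rw [abs_sub_comm] at h
  constructor <;> linarith [key a b]

lemma abs_PhiZ1_sub_solitonQ_le {p : ℝ} (hp1 : 1 < p) (hp2 : p ≤ 2) :
    ∃ A > (0 : ℝ), ∀ δ : ℝ, ∀ z : ℂ × ℂ, ‖z‖ ≤ δ → ∀ x,
      |PhiZ1 p z x - solitonQ p x| ≤ A * δ * Real.exp (-((3 - p) / 2 * |x|)) := by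
  set M : ℝ := ((p + 1) / 2) ^ (1 / (p - 1)) * (2 : ℝ) ^ (2 / (p - 1)) with hMdef
  have hM : 0 < M := by
    have : 0 < (p + 1) / 2 := by linarith
    positivity
  refine ⟨2 * (M ^ ((p + 1) / 2) + M ^ ((3 - p) / 2)), by positivity, fun δ z hz x => ?_⟩
  have hz1 : |((1 - Complex.I) * z.1).re| ≤ 2 * δ := by
    refine (Complex.abs_re_le_norm _).trans ?_
    rw [norm_mul]
    have h1 : ‖(1 : ℂ) - Complex.I‖ ≤ 2 := (norm_sub_le _ _).trans (by norm_num)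
    exact mul_le_mul h1 ((norm_fst_le z).trans hz) (norm_nonneg _) (by norm_num)
  have hz2 : |2 * z.2.re| ≤ 2 * δ := by
    rw [abs_mul, abs_two]
    have := (Complex.abs_re_le_norm z.2).trans ((norm_snd_le z).trans hz)
    linarith
  have hδ : 0 ≤ δ := (norm_nonneg z).trans hz
  have h0 : |phi0 p x| ≤ M ^ ((p + 1) / 2) * Real.exp (-((3 - p) / 2 * |x|)) := by
    unfold phi0
    rw [abs_of_nonneg (Real.rpow_nonneg (solitonQ_pos (by linarith) x).le _)]
    exact solitonQ_rpow_le hp1 (by linarith) (by linarith) x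
  have h2 : |phi2 p x| ≤ M ^ ((3 - p) / 2) * Real.exp (-((3 - p) / 2 * |x|)) :=
    (abs_phi2_le hp1 hp2 x).trans (solitonQ_rpow_le hp1 (by linarith) le_rfl x)
  have heq : PhiZ1 p z x - solitonQ p x =
      ((1 - Complex.I) * z.1).re * phi0 p x + 2 * z.2.re * phi2 p x := by
    unfold PhiZ1
    ring
  rw [heq]
  refine (abs_add_le _ _).trans ?_
  rw [abs_mul, abs_mul (2 * z.2.re)]
  calc _ ≤ 2 * δ * (M ^ ((p + 1) / 2) * Real.exp (-((3 - p) / 2 * |x|))) +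
        2 * δ * (M ^ ((3 - p) / 2) * Real.exp (-((3 - p) / 2 * |x|))) := by gcongr
    _ = _ := by ring

lemma inv_cosh_mul_exp_neg_le {κ m : ℝ} (hκ : 0 ≤ κ) (hm : 0 ≤ m) (x : ℝ) :
    (Real.cosh (κ * x))⁻¹ * Real.exp (-(m * |x|)) ≤ 2 * (Real.cosh ((κ + m) * x))⁻¹ := by
  calc _ ≤ 2 * Real.exp (-|κ * x|) * Real.exp (-(m * |x|)) := by
        gcongr
        exact inv_cosh_le_two_mul_exp_neg_abs _
    _ = 2 * Real.exp (-|(κ + m) * x|) := by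
        rw [mul_assoc, ← Real.exp_add, abs_mul, abs_mul, abs_of_nonneg hκ,
          abs_of_nonneg (add_nonneg hκ hm)]
        ring_nf
    _ ≤ _ := by
        gcongr
        exact exp_neg_abs_le_inv_cosh _

open MeasureTheory in
theorem stmt13 (p : ℝ) (hp1 : 5 / 3 < p) (hp2 : p ≤ 2) :
    ∃ δ₀ > (0 : ℝ), ∃ C > (0 : ℝ), ∀ κ : ℝ, 0 < κ → ∀ δ : ℝ, 0 < δ → δ < δ₀ →
      ∀ z : ℂ × ℂ, ‖z‖ ≤ δ → ∀ η₁ : ℝ → ℝ, Measurable η₁ →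
        eLpNorm
            (fun x => (Real.cosh (κ * x))⁻¹ *
              ((p * |PhiZ1 p z x| ^ (p - 1) - p * solitonQ p x ^ (p - 1)) * η₁ x)) 2 volume
          ≤ ENNReal.ofReal (C * δ ^ (p - 1)) *
              eLpNorm
                (fun x => (Real.cosh ((κ + (p - 1) * ((3 - p) / 2)) * x))⁻¹ * η₁ x) 2
                volume := by
  have hp : 1 < p := by linarith
  obtain ⟨A, hA, hΦ⟩ := abs_PhiZ1_sub_solitonQ_le hp hp2
  refine ⟨1, one_pos, 2 * p * A ^ (p - 1), by positivity, ?_⟩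
  intro κ hκ δ hδ _ z hz η _
  refine eLpNorm_le_mul_eLpNorm_of_ae_le_mul (Filter.Eventually.of_forall fun x => ?_) 2
  have hc1 := Real.cosh_pos (κ * x)
  have hc2 := Real.cosh_pos ((κ + (p - 1) * ((3 - p) / 2)) * x)
  have hdiff : |p * |PhiZ1 p z x| ^ (p - 1) - p * solitonQ p x ^ (p - 1)| ≤
      p * (A ^ (p - 1) * δ ^ (p - 1) * Real.exp (-((p - 1) * ((3 - p) / 2) * |x|))) := by
    rw [← mul_sub, abs_mul, abs_of_pos (by linarith : 0 < p)]
    gcongr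
    have h := abs_abs_rpow_sub_abs_rpow_le (by linarith : 0 ≤ p - 1) (by linarith)
      (PhiZ1 p z x) (solitonQ p x)
    rw [abs_of_pos (solitonQ_pos (by linarith) x)] at h
    refine h.trans ((Real.rpow_le_rpow (abs_nonneg _) (hΦ δ z hz x) (by linarith)).trans_eq ?_)
    rw [Real.mul_rpow (by positivity) (Real.exp_pos _).le, Real.mul_rpow hA.le hδ.le,
      ← Real.exp_mul]
    ring_nf
  have hm : 0 ≤ (p - 1) * ((3 - p) / 2) := mul_nonneg (by linarith) (by linarith)
  simp only [norm_mul, Real.norm_eq_abs, abs_inv, abs_of_pos hc1, abs_of_pos hc2]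
  calc _ ≤ (Real.cosh (κ * x))⁻¹ * (p * (A ^ (p - 1) * δ ^ (p - 1) *
          Real.exp (-((p - 1) * ((3 - p) / 2) * |x|))) * |η x|) := by gcongr
    _ = p * A ^ (p - 1) * δ ^ (p - 1) * |η x| * ((Real.cosh (κ * x))⁻¹ *
          Real.exp (-((p - 1) * ((3 - p) / 2) * |x|))) := by ring
    _ ≤ p * A ^ (p - 1) * δ ^ (p - 1) * |η x| *
          (2 * (Real.cosh ((κ + (p - 1) * ((3 - p) / 2)) * x))⁻¹) := by
        exact mul_le_mul_of_nonneg_left (inv_cosh_mul_exp_neg_le hκ.le hm x) (by positivity)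
    _ = _ := by ring
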